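/- arXiv:1607.03372 — 2 statements merged into one kernel-verified Lean document; each statement's English description precedes it below -/
import Mathlib

section
/- Let Γ be a simple graph that is strongly regular with parameters (275,112,30,56), and suppose that every 3-clique of Γ is contained in some 5-clique of Γ. Then every edge of Γ is contained in exactly 10 cliques of size 5. -/
open Matrix Finset in
/-- The matrix `2 I - A + (2/5) J` is positive semidefinite: it satisfies `M ^ 2 = 30 M`. -/
theorem srg275_posSemidef {V : Type*} [Fintype V] [DecidableEq V] (Γ : SimpleGraph V)
    [DecidableRel Γ.Adj] (hΓ : Γ.IsSRGWith 275 112 30 56) :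
    ((2 : ℝ) • (1 : Matrix V V ℝ) - Γ.adjMatrix ℝ
      + (2 / 5 : ℝ) • Matrix.of (fun _ _ : V => (1 : ℝ))).PosSemidef := by
  set A := Γ.adjMatrix ℝ with hA
  set J : Matrix V V ℝ := Matrix.of (fun _ _ : V => (1 : ℝ)) with hJ
  have hAJ : A * J = (112 : ℝ) • J := by
    ext i j
    simp [hA, hJ, SimpleGraph.adjMatrix_mul_apply, hΓ.regular i]
  have hJA : J * A = (112 : ℝ) • J := by
    ext i j
    simp [hA, hJ, SimpleGraph.mul_adjMatrix_apply, hΓ.regular j]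
  have hJJ : J * J = (275 : ℝ) • J := by
    ext i j
    simp [hJ, Matrix.mul_apply, hΓ.card]
  have hAA : A * A = (56 : ℝ) • (1 : Matrix V V ℝ) - (26 : ℝ) • A + (56 : ℝ) • J := by
    have h := hΓ.matrix_eq (α := ℝ)
    rw [← hA, pow_two, ← Nat.cast_smul_eq_nsmul ℝ, ← Nat.cast_smul_eq_nsmul ℝ,
      ← Nat.cast_smul_eq_nsmul ℝ] at h
    rw [h]
    ext i j
    simp only [Matrix.add_apply, Matrix.sub_apply, Matrix.smul_apply, hA, hJ,
      SimpleGraph.adjMatrix_apply, Matrix.one_apply, SimpleGraph.compl_adj, Matrix.of_apply,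
      smul_eq_mul]
    by_cases hij : i = j
    · subst hij
      simp; norm_num
    · by_cases ha : Γ.Adj i j <;>
      simp [hij, ha] <;> norm_num
  set M := (2 : ℝ) • (1 : Matrix V V ℝ) - A + (2 / 5 : ℝ) • J with hM
  have hMt : Mᴴ = M := by
    ext i j
    simp [hM, hA, hJ, Matrix.one_apply, Γ.adj_comm, eq_comm]
  have hMM : M * M = (30 : ℝ) • M := by
    simp only [hM, mul_add, add_mul, mul_sub, sub_mul, smul_mul_assoc, mul_smul_comm, one_mul,
      mul_one, hAJ, hJA, hJJ, hAA]
    module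
  have hfin : M = (1 / 30 : ℝ) • (Mᴴ * M) := by
    rw [hMt, hMM]; module
  rw [hfin]
  exact (Matrix.posSemidef_conjTranspose_mul_self M).smul (by norm_num)

open Matrix Finset in
/-- Trace inequality for the local graph. -/
theorem local_trace_le {N : Type*} [Fintype N] [DecidableEq N] (hcard : Fintype.card N = 112)
    (B : Matrix N N ℝ) (hBt : Bᵀ = B)
    (hBJ : B * Matrix.of (fun _ _ : N => (1 : ℝ)) = (30 : ℝ) • Matrix.of (fun _ _ : N => (1 : ℝ)))
    (hpsd : ((2 : ℝ) • (1 : Matrix N N ℝ) - B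
      + (2 / 5 : ℝ) • Matrix.of (fun _ _ : N => (1 : ℝ))).PosSemidef)
    (htr : B.trace = 0) (htr2 : (B * B).trace = 3360) :
    (B * (B * B)).trace ≤ 6720 := by
  set J : Matrix N N ℝ := Matrix.of (fun _ _ : N => (1 : ℝ)) with hJ
  have hJt : Jᵀ = J := by ext i j; simp [hJ]
  have hJB : J * B = (30 : ℝ) • J := by
    have := congrArg Matrix.transpose hBJ
    simpa [Matrix.transpose_mul, hBt, hJt] using this
  have hJJ : J * J = (112 : ℝ) • J := by
    ext i j
    simp [hJ, Matrix.mul_apply, hcard]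
  have htrJ : J.trace = 112 := by simp [hJ, Matrix.trace, hcard]
  have htr1 : (1 : Matrix N N ℝ).trace = 112 := by simp [hcard]
  set P := (10 : ℝ) • (1 : Matrix N N ℝ) + B - (5 / 14 : ℝ) • J with hP
  have hPt : Pᴴ = P := by
    rw [Matrix.conjTranspose_eq_transpose_of_trivial]
    simp [hP, hBt, hJt]
  have h1 := (hpsd.mul_mul_conjTranspose_same P).trace_nonneg
  rw [hPt] at h1
  have h2 : P * ((2 : ℝ) • (1 : Matrix N N ℝ) - B + (2 / 5 : ℝ) • J) * P
      = (200 : ℝ) • (1 : Matrix N N ℝ) - (60 : ℝ) • B - (18 : ℝ) • (B * B) - B * (B * B)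
        + (400 : ℝ) • J := by
    simp only [hP, mul_add, add_mul, mul_sub, sub_mul, smul_mul_assoc, mul_smul_comm, one_mul,
      mul_one, hBJ, hJB, hJJ, mul_assoc, smul_add, smul_sub]
    module
  rw [h2] at h1
  simp only [Matrix.trace_add, Matrix.trace_sub, Matrix.trace_smul, htr, htr1, htr2, htrJ,
    smul_eq_mul] at h1
  linarith

open Finset in
/-- Each triangle has exactly two common neighbours, if each has at least two. -/
theorem triangle_two {V : Type*} [Fintype V] [DecidableEq V] (Γ : SimpleGraph V)
    [DecidableRel Γ.Adj] (hΓ : Γ.IsSRGWith 275 112 30 56)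
    (h2 : ∀ x y z, Γ.Adj x y → Γ.Adj x z → Γ.Adj y z →
      2 ≤ #{t | Γ.Adj x t ∧ Γ.Adj y t ∧ Γ.Adj z t}) :
    ∀ x y z, Γ.Adj x y → Γ.Adj x z → Γ.Adj y z →
      #{t | Γ.Adj x t ∧ Γ.Adj y t ∧ Γ.Adj z t} = 2 := by
  intro x
  let N := {t // Γ.Adj x t}
  let B : Matrix N N ℝ := (Γ.adjMatrix ℝ).submatrix Subtype.val Subtype.val
  have hB : ∀ i j : N, B i j = if Γ.Adj i j then 1 else 0 := fun i j => by
    simp [B]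
  have hcard : Fintype.card N = 112 := by
    rw [← hΓ.regular x, ← Γ.card_neighborFinset_eq_degree, Fintype.card_subtype]
    congr 1; ext t; simp
  have hsumN : ∀ f : V → ℝ, ∑ j : N, f j = ∑ t with Γ.Adj x t, f t := by
    intro f
    exact (Finset.sum_subtype _ (by simp) f).symm
  have hdeg : ∀ i : N, ∑ j, B i j = 30 := by
    intro i
    have h30 := hΓ.of_adj x i i.2
    have hF : #{t | Γ.Adj x t ∧ Γ.Adj (i : V) t} = 30 := by
      rw [← h30, ← Set.toFinset_card]
      congr 1; ext t; simp [SimpleGraph.mem_commonNeighbors]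
    simp only [hB]
    rw [hsumN (fun t => if Γ.Adj (i : V) t then (1 : ℝ) else 0), Finset.sum_boole,
      filter_filter, hF]
    norm_num
  have hBt : B.transpose = B := by
    ext i j; simp [hB, Γ.adj_comm]
  have hBB : ∀ i j : N, (B * B) i j
      = (#{t | Γ.Adj x t ∧ Γ.Adj (i : V) t ∧ Γ.Adj (j : V) t} : ℝ) := by
    intro i j
    rw [Matrix.mul_apply]
    simp only [hB]
    rw [hsumN (fun t => (if Γ.Adj (i : V) t then (1 : ℝ) else 0)
      * (if Γ.Adj t (j : V) then (1 : ℝ) else 0))]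
    simp only [← ite_and, mul_ite, mul_one, mul_zero, Γ.adj_comm _ (j : V)]
    rw [Finset.sum_boole, filter_filter]
    congr 2; ext t; simp; tauto
  have htr := local_trace_le hcard B hBt
    (by ext i j; simp [Matrix.mul_apply, hdeg])
    (by
      have := (srg275_posSemidef Γ hΓ).submatrix (Subtype.val : N → V)
      convert this using 1
      ext i j
      have hij : i = j ↔ (i : V) = (j : V) := Subtype.ext_iff
      simp [B, Matrix.one_apply, hij])
    (by simp [Matrix.trace, hB])
    (by
      have : ∀ i, (B * B) i i = 30 := fun i => by
        rw [← hdeg i, Matrix.mul_apply]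
        refine sum_congr rfl fun j _ => ?_
        simp only [hB, Γ.adj_comm j i]
        split_ifs <;> simp
      simp only [Matrix.trace, Matrix.diag, this, sum_const, card_univ, hcard]
      norm_num)
  have hsum : ∑ i, ∑ j, B i j * ((B * B) i j - 2) ≤ 0 := by
    have e1 : ∑ i, ∑ j, B i j * ((B * B) i j) = (B * (B * B)).trace := by
      simp only [Matrix.trace, Matrix.diag]
      refine sum_congr rfl fun i _ => ?_
      rw [Matrix.mul_apply]
      refine sum_congr rfl fun j _ => ?_
      have : (B * B).transpose = B * B := by rw [Matrix.transpose_mul, hBt]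
      conv_lhs => rw [← this]
      rfl
    have e2 : ∑ i, ∑ j, B i j * 2 = 6720 := by
      simp only [← sum_mul, hdeg, sum_const, card_univ, hcard]; norm_num
    simp only [mul_sub, sum_sub_distrib, e1, e2]
    linarith
  have hnn : ∀ i j, 0 ≤ B i j * ((B * B) i j - 2) := by
    intro i j
    rw [hB]
    split_ifs with h
    · have := h2 x i j i.2 j.2 h
      rw [hBB]
      have : (2 : ℝ) ≤ (#{t | Γ.Adj x t ∧ Γ.Adj (i : V) t ∧ Γ.Adj (j : V) t} : ℝ) := by
        exact_mod_cast this
      linarith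
    · simp
  intro y z hy hz hyz
  have h0 : ∑ i, ∑ j, B i j * ((B * B) i j - 2) = 0 :=
    le_antisymm hsum (sum_nonneg fun i _ => sum_nonneg fun j _ => hnn i j)
  rw [sum_eq_zero_iff_of_nonneg (fun i _ => sum_nonneg fun j _ => hnn i j)] at h0
  have h3 := h0 ⟨y, hy⟩ (mem_univ _)
  rw [sum_eq_zero_iff_of_nonneg (fun j _ => hnn _ j)] at h3
  have h4 := h3 ⟨z, hz⟩ (mem_univ _)
  rw [hB, if_pos hyz, hBB] at h4
  have h5 : (#{t | Γ.Adj x t ∧ Γ.Adj y t ∧ Γ.Adj z t} : ℝ) = 2 := by linarith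
  exact_mod_cast h5

/-- Let Γ be a strongly regular graph with parameters (275,112,30,56) in which
every 3-clique is contained in some 5-clique.  Then every edge of Γ is contained
in exactly 10 cliques of size 5. -/
theorem srg_275_edge_in_ten_five_cliques
    {V : Type*} [Fintype V] (Γ : SimpleGraph V) [DecidableRel Γ.Adj]
    (hΓ : Γ.IsSRGWith 275 112 30 56)
    (hext : ∀ T : Finset V, Γ.IsNClique 3 T → ∃ C : Finset V, Γ.IsNClique 5 C ∧ T ⊆ C) :
    ∀ u v : V, Γ.Adj u v →
      {C : Finset V | Γ.IsNClique 5 C ∧ u ∈ C ∧ v ∈ C}.ncard = 10 := by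
  classical
  have hsub : ∀ x y z (C : Finset V), Γ.IsNClique 5 C → x ∈ C → y ∈ C → z ∈ C →
      C \ {x, y, z} ⊆ Finset.univ.filter (fun t => Γ.Adj x t ∧ Γ.Adj y t ∧ Γ.Adj z t) := by
    intro x y z C hC hx hy hz t ht
    simp only [Finset.mem_sdiff, Finset.mem_insert, Finset.mem_singleton, not_or] at ht
    obtain ⟨htC, h1, h2, h3⟩ := ht
    simp only [Finset.mem_filter, Finset.mem_univ, true_and]
    exact ⟨hC.1 hx htC (Ne.symm h1), hC.1 hy htC (Ne.symm h2), hC.1 hz htC (Ne.symm h3)⟩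
  have hcd : ∀ x y z (C : Finset V), Γ.IsNClique 5 C → x ∈ C → y ∈ C → z ∈ C →
      Γ.Adj x y → Γ.Adj x z → Γ.Adj y z → (C \ {x, y, z}).card = 2 := by
    intro x y z C hC hx hy hz hxy hxz hyz
    have h3 : ({x, y, z} : Finset V).card = 3 :=
      Finset.card_eq_three.2 ⟨x, y, z, hxy.ne, hxz.ne, hyz.ne, rfl⟩
    rw [Finset.card_sdiff_of_subset, hC.2, h3]
    intro t ht
    simp only [Finset.mem_insert, Finset.mem_singleton] at ht
    rcases ht with rfl | rfl | rfl <;> assumption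
  have hex : ∀ x y z, Γ.Adj x y → Γ.Adj x z → Γ.Adj y z →
      ∃ C : Finset V, Γ.IsNClique 5 C ∧ x ∈ C ∧ y ∈ C ∧ z ∈ C := by
    intro x y z hxy hxz hyz
    obtain ⟨C, hC, hT⟩ := hext {x, y, z} (SimpleGraph.is3Clique_triple_iff.2 ⟨hxy, hxz, hyz⟩)
    exact ⟨C, hC, hT (by simp), hT (by simp), hT (by simp)⟩
  have htwo := triangle_two Γ hΓ (by
    intro x y z hxy hxz hyz
    obtain ⟨C, hC, hx, hy, hz⟩ := hex x y z hxy hxz hyz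
    rw [← hcd x y z C hC hx hy hz hxy hxz hyz]
    exact Finset.card_le_card (hsub x y z C hC hx hy hz))
  intro u v huv
  have hset : {C : Finset V | Γ.IsNClique 5 C ∧ u ∈ C ∧ v ∈ C}
      = ((Finset.univ.filter fun C : Finset V => Γ.IsNClique 5 C ∧ u ∈ C ∧ v ∈ C :
        Finset (Finset V)) : Set (Finset V)) := by
    ext C; simp
  rw [hset, Set.ncard_coe_finset]
  set S := (Finset.univ.filter fun C : Finset V => Γ.IsNClique 5 C ∧ u ∈ C ∧ v ∈ C) with hS
  set W := (Finset.univ.filter fun t => Γ.Adj u t ∧ Γ.Adj v t) with hW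
  have hWc : W.card = 30 := by
    rw [← hΓ.of_adj u v huv, ← Set.toFinset_card]
    congr 1; ext t; simp [hW, SimpleGraph.mem_commonNeighbors]
  have key := Finset.card_mul_eq_card_mul (s := S) (t := W) (m := 3) (n := 1)
    (fun (C : Finset V) t => t ∈ C)
    (by
      intro C hC
      simp only [hS, Finset.mem_filter, Finset.mem_univ, true_and] at hC
      obtain ⟨hC, hu, hv⟩ := hC
      have : Finset.bipartiteAbove (fun (C : Finset V) t => t ∈ C) W C = C \ {u, v} := by
        ext t
        simp only [Finset.mem_bipartiteAbove, hW, Finset.mem_filter, Finset.mem_univ, true_and,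
          Finset.mem_sdiff, Finset.mem_insert, Finset.mem_singleton, not_or]
        constructor
        · rintro ⟨⟨h1, h2⟩, h3⟩
          exact ⟨h3, h1.ne.symm, h2.ne.symm⟩
        · rintro ⟨h3, h1, h2⟩
          exact ⟨⟨hC.1 hu h3 (Ne.symm h1), hC.1 hv h3 (Ne.symm h2)⟩, h3⟩
      rw [this, Finset.card_sdiff_of_subset, hC.2, Finset.card_pair huv.ne]
      intro t ht
      simp only [Finset.mem_insert, Finset.mem_singleton] at ht
      rcases ht with rfl | rfl <;> assumption)
    (by
      intro w hw
      simp only [hW, Finset.mem_filter, Finset.mem_univ, true_and] at hw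
      obtain ⟨huw, hvw⟩ := hw
      have huniq : ∀ C : Finset V, Γ.IsNClique 5 C → u ∈ C → v ∈ C → w ∈ C →
          C = {u, v, w} ∪ Finset.univ.filter (fun t => Γ.Adj u t ∧ Γ.Adj v t ∧ Γ.Adj w t) := by
        intro C hC hu hv hw
        rw [← Finset.eq_of_subset_of_card_le (hsub u v w C hC hu hv hw)
          (by rw [hcd u v w C hC hu hv hw huv huw hvw, htwo u v w huv huw hvw])]
        rw [Finset.union_sdiff_of_subset]
        intro t ht
        simp only [Finset.mem_insert, Finset.mem_singleton] at ht
        rcases ht with rfl | rfl | rfl <;> assumption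
      obtain ⟨C, hC, hu, hv, hw⟩ := hex u v w huv huw hvw
      rw [Finset.card_eq_one]
      refine ⟨C, ?_⟩
      ext D
      simp only [Finset.mem_bipartiteBelow, hS, Finset.mem_filter, Finset.mem_univ, true_and,
        Finset.mem_singleton]
      constructor
      · rintro ⟨⟨hD, hu', hv'⟩, hw'⟩
        rw [huniq D hD hu' hv' hw', ← huniq C hC hu hv hw]
      · rintro rfl
        exact ⟨⟨hC, hu, hv⟩, hw⟩)
  omega
end

section
/- Let Γ be a simple graph that is strongly regular with parameters (275,112,30,56), and suppose that every 3-clique of Γ is contained in some 5-clique of Γ. Then every vertex of Γ is contained in exactly 280 cliques of size 5. -/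
open Finset in
/-- Vanishing of the triple product sum (Krein condition with equality), as a sum of squares. -/
lemma triple_sum_zero {V : Type*} [Fintype V] (M : V → V → ℤ) (c : ℤ)
    (hM : ∀ x y, ∑ w, M x w * M y w = c * M x y)
    (h3 : ∀ x, ∑ y, M x y ^ 3 = 0) (x y z : V) :
    ∑ w, M w x * M w y * M w z = 0 := by
  have key : ∑ x, ∑ y, ∑ z, (∑ w, M w x * M w y * M w z) ^ 2 = 0 := by
    have e : ∀ x y z, (∑ w, M w x * M w y * M w z) ^ 2
        = ∑ w, ∑ u, (M w x * M u x) * (M w y * M u y) * (M w z * M u z) := by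
      intro x y z
      rw [sq, sum_mul_sum]
      refine sum_congr rfl fun w _ => sum_congr rfl fun u _ => by ring
    have e2 : ∀ w u, ∑ x, ∑ y, ∑ z, (M w x * M u x) * (M w y * M u y) * (M w z * M u z)
        = (c * M w u) ^ 3 := by
      intro w u
      rw [← hM w u]
      simp only [← mul_sum, ← sum_mul]
      ring
    calc ∑ x, ∑ y, ∑ z, (∑ w, M w x * M w y * M w z) ^ 2
        = ∑ x, ∑ y, ∑ w, ∑ u, ∑ z, (M w x * M u x) * (M w y * M u y) * (M w z * M u z) := by
          refine sum_congr rfl fun x _ => sum_congr rfl fun y _ => ?_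
          simp only [e]
          rw [sum_comm]
          refine sum_congr rfl fun w _ => ?_
          rw [sum_comm]
      _ = ∑ x, ∑ w, ∑ u, ∑ y, ∑ z, (M w x * M u x) * (M w y * M u y) * (M w z * M u z) := by
          refine sum_congr rfl fun x _ => ?_
          rw [sum_comm]
          refine sum_congr rfl fun w _ => ?_
          rw [sum_comm]
      _ = ∑ w, ∑ u, ∑ x, ∑ y, ∑ z, (M w x * M u x) * (M w y * M u y) * (M w z * M u z) := by
          rw [sum_comm]
          refine sum_congr rfl fun w _ => ?_
          rw [sum_comm]
      _ = 0 := by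
          simp only [e2]
          simp only [mul_pow, ← mul_sum, h3, mul_zero, sum_const_zero]
  have h1 := (sum_eq_zero_iff_of_nonneg (fun x _ => sum_nonneg fun y _ => sum_nonneg fun z _ =>
    sq_nonneg _)).1 key x (mem_univ _)
  have h2 := (sum_eq_zero_iff_of_nonneg (fun y _ => sum_nonneg fun z _ =>
    sq_nonneg _)).1 h1 y (mem_univ _)
  have h3 := (sum_eq_zero_iff_of_nonneg (fun z _ => sq_nonneg _)).1 h2 z (mem_univ _)
  exact pow_eq_zero_iff (two_ne_zero) |>.1 h3

open Finset in
/-- Common neighbours of two adjacent vertices, as a filter. -/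
lemma card_common {V : Type*} [Fintype V] [DecidableEq V] (Γ : SimpleGraph V)
    [DecidableRel Γ.Adj] (x y : V) :
    Fintype.card (Γ.commonNeighbors x y) = #{w | Γ.Adj x w ∧ Γ.Adj y w} := by
  rw [← Set.toFinset_card]
  congr 1
  ext w
  simp [SimpleGraph.mem_commonNeighbors]

open Finset in
/-- Every triangle has exactly two common neighbours. -/
lemma triangle_common {V : Type*} [Fintype V] [DecidableEq V] (Γ : SimpleGraph V)
    [DecidableRel Γ.Adj] (hΓ : Γ.IsSRGWith 275 112 30 56) (x y z : V)
    (hxy : Γ.Adj x y) (hxz : Γ.Adj x z) (hyz : Γ.Adj y z) :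
    #{w | Γ.Adj x w ∧ Γ.Adj y w ∧ Γ.Adj z w} = 2 := by
  let a : V → V → ℤ := fun u w => if Γ.Adj u w then 1 else 0
  let d : V → V → ℤ := fun u w => if u = w then 1 else 0
  have asymm : ∀ u w, a u w = a w u := by intro u w; simp [a, Γ.adj_comm]
  have dsymm : ∀ u w, d u w = d w u := by intro u w; simp [d, eq_comm]
  have hone : ∑ _w : V, (1 : ℤ) = 275 := by simp [hΓ.card]
  have hd : ∀ u, ∑ w, d u w = 1 := by intro u; simp [d]
  have hdf : ∀ u (f : V → ℤ), ∑ w, d u w * f w = f u := by intro u f; simp [d]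
  have ha : ∀ u, ∑ w, a u w = 112 := by
    intro u
    have := hΓ.regular.degree_eq u
    rw [← SimpleGraph.card_neighborFinset_eq_degree, SimpleGraph.neighborFinset_eq_filter] at this
    simp [a, this]
  have haa' : ∀ u v, ∑ w, a u w * a v w = (Fintype.card (Γ.commonNeighbors u v) : ℤ) := by
    intro u v
    rw [card_common]
    simp [a, ← ite_and]
    congr 2
    ext w
    simp [and_comm]
  have haa : ∀ u v, ∑ w, a u w * a v w = 56 + 56 * d u v - 26 * a u v := by
    intro u v
    by_cases huv : u = v
    · subst huv
      have : ∀ w, a u w * a u w = a u w := by intro w; simp [a]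
      simp only [this, ha]
      simp [a, d]
    · rw [haa']
      by_cases h : Γ.Adj u v
      · rw [hΓ.of_adj u v h]; simp [a, d, h, huv]
      · rw [hΓ.of_not_adj huv h]; simp [a, d, h, huv]
  let M : V → V → ℤ := fun u w => 2 + 10 * d u w - 5 * a u w
  have hMM : ∀ u v, ∑ w, M u w * M v w = 150 * M u v := by
    intro u v
    have : ∀ w, M u w * M v w = 4 * 1 + 20 * d u w - 10 * a u w + 20 * d v w - 10 * a v w
        + 100 * (d u w * d v w) - 50 * (d u w * a v w) - 50 * (d v w * a u w)
        + 25 * (a u w * a v w) := by intro w; simp only [M]; ring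
    simp only [this, sum_add_distrib, sum_sub_distrib, ← mul_sum, hone, hd, ha, haa, hdf, M]
    rw [asymm v u, dsymm v u]
    ring
  have hM3 : ∀ u, ∑ w, M u w ^ 3 = 0 := by
    intro u
    have : ∀ w, M u w ^ 3 = 8 * 1 + 1720 * d u w - 35 * a u w := by
      intro w
      by_cases h1 : u = w
      · subst h1; simp [M, a, d]
      · by_cases h2 : Γ.Adj u w <;> simp [M, a, d, h1, h2]
    simp only [this, sum_add_distrib, sum_sub_distrib, ← mul_sum, hone, hd, ha]
    norm_num
  have hsymm : ∀ u w, M u w = M w u := by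
    intro u w; simp only [M, asymm u w, dsymm u w]
  have h0 := triple_sum_zero M 150 hMM hM3 x y z
  have hpt : ∀ w, M w x * M w y * M w z = 8 * 1 - 20 * a x w - 20 * a y w - 20 * a z w
      + 50 * (a x w * a y w) + 50 * (a x w * a z w) + 50 * (a y w * a z w)
      - 125 * (a x w * a y w * a z w) + 90 * d x w + 90 * d y w + 90 * d z w := by
    intro w
    have nxy := hxy.ne
    have nxz := hxz.ne
    have nyz := hyz.ne
    rw [hsymm w x, hsymm w y, hsymm w z]
    by_cases h1 : x = w
    · subst h1; simp [M, a, d, nxy.symm, nxz.symm, hxy.symm, hxz.symm]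
    by_cases h2 : y = w
    · subst h2; simp [M, a, d, nxy, nyz.symm, hxy, hyz.symm]
    by_cases h3 : z = w
    · subst h3; simp [M, a, d, nxz, nyz, hxz, hyz]
    simp only [M, d, h1, h2, h3, if_false]
    ring
  have hax : a x y = 1 ∧ a x z = 1 ∧ a y z = 1 ∧ d x y = 0 ∧ d x z = 0 ∧ d y z = 0 := by
    simp [a, d, hxy, hxz, hyz, hxy.ne, hxz.ne, hyz.ne]
  obtain ⟨q1, q2, q3, q4, q5, q6⟩ := hax
  simp only [hpt, sum_add_distrib, sum_sub_distrib, ← mul_sum, hone, hd, ha, haa,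
    q1, q2, q3, q4, q5, q6] at h0
  have hcount : ∑ w, a x w * a y w * a z w = (#{w | Γ.Adj x w ∧ Γ.Adj y w ∧ Γ.Adj z w} : ℤ) := by
    rw [card_filter]
    push_cast
    refine sum_congr rfl fun w _ => ?_
    by_cases h1 : Γ.Adj x w <;> by_cases h2 : Γ.Adj y w <;> by_cases h3 : Γ.Adj z w <;>
      simp [a, h1, h2, h3]
  rw [hcount] at h0
  omega

open Finset in

/-- Let Γ be a strongly regular graph with parameters (275,112,30,56) in which
every 3-clique is contained in some 5-clique.  Then every vertex of Γ is contained
in exactly 280 cliques of size 5. -/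
theorem srg_275_vertex_in_280_five_cliques
    {V : Type*} [Fintype V] (Γ : SimpleGraph V) [DecidableRel Γ.Adj]
    (hΓ : Γ.IsSRGWith 275 112 30 56)
    (hext : ∀ T : Finset V, Γ.IsNClique 3 T → ∃ C : Finset V, Γ.IsNClique 5 C ∧ T ⊆ C) :
    ∀ v : V, {C : Finset V | Γ.IsNClique 5 C ∧ v ∈ C}.ncard = 280 := by
  classical
  intro v
  have hset : {C : Finset V | Γ.IsNClique 5 C ∧ v ∈ C}
      = ((univ.filter fun C : Finset V => Γ.IsNClique 5 C ∧ v ∈ C : Finset (Finset V)) :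
        Set (Finset V)) := by ext; simp
  rw [hset, Set.ncard_coe_finset]
  set T : Finset (Finset V) := univ.filter fun C : Finset V => Γ.IsNClique 5 C ∧ v ∈ C with hT
  let P : Finset (V × V) := univ.filter fun p => Γ.Adj v p.1 ∧ (Γ.Adj v p.2 ∧ Γ.Adj p.1 p.2)
  have hP : #P = 3360 := by
    have h1 : #P = ∑ x ∈ Γ.neighborFinset v, #{w | Γ.Adj v w ∧ Γ.Adj x w} := by
      simp only [P, card_filter]
      rw [Fintype.sum_prod_type, SimpleGraph.neighborFinset_eq_filter, sum_filter]
      refine sum_congr rfl fun x _ => ?_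
      by_cases h : Γ.Adj v x <;> simp [h]
    rw [h1, sum_congr rfl (g := fun _ => 30)]
    · rw [sum_const, SimpleGraph.card_neighborFinset_eq_degree, hΓ.regular.degree_eq]; rfl
    · intro x hx
      rw [← card_common]
      exact hΓ.of_adj v x (by simpa using hx)
  have hdc := card_mul_eq_card_mul (s := P) (t := T) (m := 1) (n := 12)
    (fun (p : V × V) (C : Finset V) => p.1 ∈ C ∧ p.2 ∈ C) ?_ ?_
  · omega
  · rintro ⟨x, y⟩ hp
    obtain ⟨hvx, hvy, hxy⟩ : Γ.Adj v x ∧ Γ.Adj v y ∧ Γ.Adj x y := by simpa [P] using hp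
    obtain ⟨C, hC, hsub⟩ := hext {v, x, y} (SimpleGraph.is3Clique_triple_iff.2 ⟨hvx, hvy, hxy⟩)
    have hN := triangle_common Γ hΓ v x y hvx hvy hxy
    set N : Finset V := univ.filter fun w => Γ.Adj v w ∧ Γ.Adj x w ∧ Γ.Adj y w with hNdef
    have huniq : ∀ D : Finset V, Γ.IsNClique 5 D → {v, x, y} ⊆ D → D = {v, x, y} ∪ N := by
      intro D hD hs
      have hc3 : #({v, x, y} : Finset V) = 3 := by
        rw [card_eq_three]; exact ⟨v, x, y, hvx.ne, hvy.ne, hxy.ne, rfl⟩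
      have hcard : #(D \ {v, x, y}) = 2 := by
        rw [card_sdiff_of_subset hs, hc3, hD.card_eq]
      have hle : D \ {v, x, y} ⊆ N := by
        intro w hw
        simp only [mem_sdiff, mem_insert, mem_singleton, not_or] at hw
        obtain ⟨hwD, h1, h2, h3⟩ := hw
        have hcl := hD.isClique
        simp only [hNdef, mem_filter, mem_univ, true_and]
        exact ⟨hcl (hs (by simp)) hwD (Ne.symm h1), hcl (hs (by simp)) hwD (Ne.symm h2),
          hcl (hs (by simp)) hwD (Ne.symm h3)⟩
      have heq := eq_of_subset_of_card_le hle (by omega)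
      rw [← heq, union_sdiff_of_subset hs]
    rw [card_eq_one]
    refine ⟨C, ?_⟩
    ext D
    simp only [mem_bipartiteAbove, hT, mem_filter, mem_univ, true_and, mem_singleton]
    constructor
    · rintro ⟨⟨hD, hv⟩, h1, h2⟩
      rw [huniq C hC hsub]
      exact huniq D hD (by intro w hw; simp at hw; rcases hw with rfl | rfl | rfl <;> assumption)
    · rintro rfl
      exact ⟨⟨hC, hsub (by simp)⟩, hsub (by simp), hsub (by simp)⟩
  · intro C hC
    obtain ⟨hC, hv⟩ : Γ.IsNClique 5 C ∧ v ∈ C := by simpa [hT] using hC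
    have : P.bipartiteBelow (fun (p : V × V) (C : Finset V) => p.1 ∈ C ∧ p.2 ∈ C) C
        = (C.erase v).offDiag := by
      ext ⟨x, y⟩
      simp only [mem_bipartiteBelow, P, mem_filter, mem_univ, true_and, mem_offDiag, mem_erase]
      constructor
      · rintro ⟨⟨h1, h2, h3⟩, h4, h5⟩
        exact ⟨⟨h1.ne', h4⟩, ⟨h2.ne', h5⟩, h3.ne⟩
      · rintro ⟨⟨h1, h4⟩, ⟨h2, h5⟩, h3⟩
        have hcl := hC.isClique
        exact ⟨⟨hcl hv h4 (Ne.symm h1), hcl hv h5 (Ne.symm h2), hcl h4 h5 h3⟩, h4, h5⟩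
    rw [this, offDiag_card, card_erase_of_mem hv, hC.card_eq]
end
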